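/- Let p, r, m ≥ 1 with r ≤ p, let A be a linear map from the space of real p×p matrices to ℝ^m, and let γ ∈ (0,1) be such that for every symmetric real p×p matrix M of rank at most 2r, (1−γ)‖M‖_F² ≤ ‖A M‖₂² ≤ (1+γ)‖M‖_F². Let Z0 be a real p×r matrix of rank r, set y = A(Z0Z0ᵀ) ∈ ℝ^m and g(Z) := ‖A(ZZᵀ) − y‖₂² for Z ∈ ℝ^{p×r} (noiseless case e = 0, so Z0 is a global minimizer with g(Z0) = 0). Let σ_max(Z0) and σ_min(Z0) be the largest and smallest singular values of Z0 (the square roots of the largest and smallest eigenvalues of Z0ᵀZ0), and set β_LR := (1/8)·(1−γ)·σ_min(Z0)² / ((1+γ)·σ_max(Z0)). Then Λ_{β_LR} := {Z ∈ ℝ^{p×r} : inf_{H ∈ O(r)} ‖ZH − Z0‖_F < β_LR} is a g-basin of attraction of Z0: there exists a step size τ > 0 such that for every initialization Z⁰ ∈ Λ_{β_LR}, the gradient-descent iterates Z_{n+1} = Z_n − τ∇g(Z_n) (gradient with respect to the Frobenius inner product ⟨X,Y⟩_F = tr(XᵀY)) satisfy g(Z_n) → 0. -/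

import Mathlib

open Matrix

theorem isCompact_orthogonal (n : Type*) [Fintype n] [DecidableEq n] :
    IsCompact {Q : Matrix n n ℝ | Qᵀ * Q = 1} := by
  have hK : IsCompact (Set.univ.pi fun _ : n => Set.univ.pi fun _ : n => Set.Icc (-1 : ℝ) 1) :=
    isCompact_univ_pi fun _ => isCompact_univ_pi fun _ => isCompact_Icc
  refine hK.of_isClosed_subset (isClosed_eq (by fun_prop) (by fun_prop)) ?_
  intro (Q : Matrix n n ℝ) hQ i _ j _
  have hu : Q ∈ unitaryGroup n ℝ := by
    rw [mem_unitaryGroup_iff', star_eq_conjTranspose, conjTranspose_eq_transpose_of_trivial]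
    exact hQ
  exact abs_le.mp (entry_norm_bound_of_unitary hu i j)

section Frobenius

open scoped Matrix.Norms.Frobenius

theorem frobenius_norm_sq {m n : Type*} [Fintype m] [Fintype n] (M : Matrix m n ℝ) :
    ‖M‖ ^ 2 = ∑ i, ∑ j, M i j ^ 2 := by
  rw [frobenius_norm_def, ← Real.rpow_natCast, ← Real.rpow_mul (by positivity)]
  simp

theorem frobenius_norm_sq_eq_trace {m n : Type*} [Fintype m] [Fintype n] (M : Matrix m n ℝ) :
    ‖M‖ ^ 2 = (Mᵀ * M).trace := by
  rw [frobenius_norm_sq, Finset.sum_comm]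
  simp [trace, mul_apply, sq]

theorem frobenius_norm_mul_orthogonal {m n : Type*} [Fintype m] [Fintype n] [DecidableEq n]
    (M : Matrix m n ℝ) {Q : Matrix n n ℝ} (hQ : Qᵀ * Q = 1) : ‖M * Q‖ = ‖M‖ := by
  have hQ' : Q * Qᵀ = 1 := mul_eq_one_comm.mp hQ
  refine (sq_eq_sq₀ (norm_nonneg _) (norm_nonneg _)).mp ?_
  rw [frobenius_norm_sq_eq_trace, frobenius_norm_sq_eq_trace, transpose_mul, trace_mul_comm]
  have : M * Q * (Qᵀ * Mᵀ) = M * Mᵀ := by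
    rw [Matrix.mul_assoc, ← Matrix.mul_assoc Q, hQ', Matrix.one_mul]
  rw [this, trace_mul_comm]

theorem frobenius_norm_sub_sq {m n : Type*} [Fintype m] [Fintype n] (M N : Matrix m n ℝ) :
    ‖M - N‖ ^ 2 = ‖M‖ ^ 2 + ‖N‖ ^ 2 - 2 * (Mᵀ * N).trace := by
  simp only [frobenius_norm_sq_eq_trace, transpose_sub, Matrix.sub_mul, Matrix.mul_sub, trace_sub]
  have : (Nᵀ * M).trace = (Mᵀ * N).trace := by
    rw [← trace_transpose, transpose_mul, transpose_transpose]
  rw [this]; ring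

/-- A matrix whose trace cannot be increased by an orthogonal factor is symmetric. -/
theorem isSymm_of_trace_mul_orthogonal_le {n : Type*} [Fintype n] [DecidableEq n]
    {M : Matrix n n ℝ} (h : ∀ R : Matrix n n ℝ, Rᵀ * R = 1 → (M * R).trace ≤ M.trace) :
    M.IsSymm := by
  set K : Matrix n n ℝ := M - Mᵀ with hK
  have hKt : Kᵀ = -K := by simp [hK]
  have horth (t : ℝ) : (NormedSpace.exp (t • K))ᵀ * NormedSpace.exp (t • K) = 1 := by
    rw [← Matrix.exp_transpose, transpose_smul, hKt, smul_neg, Matrix.exp_neg]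
    exact nonsing_inv_mul _ ((isUnit_iff_isUnit_det _).mp (Matrix.isUnit_exp _))
  let L : Matrix n n ℝ →L[ℝ] ℝ :=
    LinearMap.toContinuousLinearMap ((traceLinearMap n ℝ ℝ) ∘ₗ LinearMap.mulLeft ℝ M)
  have hL (R : Matrix n n ℝ) : L R = (M * R).trace := rfl
  have hd : HasDerivAt (fun t : ℝ => L (NormedSpace.exp (t • K))) (L K) 0 := by
    have := hasDerivAt_exp_smul_const (𝕂 := ℝ) K (0 : ℝ)
    simp only [zero_smul, NormedSpace.exp_zero, one_mul] at this
    exact L.hasFDerivAt.comp_hasDerivAt (0 : ℝ) this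
  have hmax : IsLocalMax (fun t : ℝ => L (NormedSpace.exp (t • K))) 0 := by
    refine Filter.Eventually.of_forall fun t => ?_
    simp only [hL, zero_smul, NormedSpace.exp_zero, mul_one]
    exact h _ (horth t)
  have h0 : (M * K).trace = 0 := hmax.hasDerivAt_eq_zero hd
  have hz : ‖K‖ ^ 2 = 0 := by
    have h1 : (Mᵀ * K).trace = -(M * K).trace := by
      rw [← trace_transpose, transpose_mul, transpose_transpose, hKt, Matrix.neg_mul, trace_neg,
        trace_mul_comm]
    have h2 : Kᵀ * K = Mᵀ * K - M * K := by
      rw [← Matrix.sub_mul, hKt, hK, neg_sub]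
    rw [frobenius_norm_sq_eq_trace, h2, trace_sub, h1, h0]; simp
  have : K = 0 := by simpa using hz
  exact (sub_eq_zero.mp this).symm

/-- A solution of the orthogonal Procrustes problem is aligned with its target. -/
theorem exists_orthogonal_aligned {m n : Type*} [Fintype m] [Fintype n] [DecidableEq n]
    (Z Z0 : Matrix m n ℝ) :
    ∃ Q : Matrix n n ℝ, Qᵀ * Q = 1 ∧ (Zᵀ * (Z0 * Q)).IsSymm ∧
      ∀ R : Matrix n n ℝ, Rᵀ * R = 1 → ‖Z - Z0 * Q‖ ≤ ‖Z - Z0 * R‖ := by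
  obtain ⟨Q, hQ, hmin⟩ := (isCompact_orthogonal n).exists_isMinOn ⟨1, by simp⟩
    (f := fun Q => ‖Z - Z0 * Q‖) (Continuous.continuousOn (by fun_prop))
  refine ⟨Q, hQ, isSymm_of_trace_mul_orthogonal_le fun R hR => ?_, fun R hR => hmin hR⟩
  have hQR : (Q * R)ᵀ * (Q * R) = 1 := by
    rw [transpose_mul, Matrix.mul_assoc, ← Matrix.mul_assoc Qᵀ, hQ, Matrix.one_mul, hR]
  have h := pow_le_pow_left₀ (norm_nonneg _) (hmin hQR) 2
  simp only [frobenius_norm_sub_sq, frobenius_norm_mul_orthogonal _ hQ,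
    frobenius_norm_mul_orthogonal _ hQR] at h
  rw [Matrix.mul_assoc, Matrix.mul_assoc]
  linarith

theorem two_mul_norm_sq_le_norm_add_transpose_sq {m n : Type*} [Fintype m] [Fintype n]
    {X D : Matrix m n ℝ} (h : (Dᵀ * X).IsSymm) :
    2 * ‖X * Dᵀ‖ ^ 2 ≤ ‖X * Dᵀ + D * Xᵀ‖ ^ 2 := by
  have h1 : ‖X * Dᵀ + D * Xᵀ‖ ^ 2 = 2 * ‖X * Dᵀ‖ ^ 2 + 2 * (Dᵀ * X * (Dᵀ * X)).trace := by
    have e := frobenius_norm_sub_sq (X * Dᵀ) (-(X * Dᵀ)ᵀ)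
    rw [norm_neg, frobenius_norm_transpose] at e
    simp only [sub_neg_eq_add, transpose_mul, transpose_transpose, Matrix.mul_neg, trace_neg] at e
    have e2 : (D * Xᵀ * (D * Xᵀ)).trace = (Dᵀ * X * (Dᵀ * X)).trace := by
      rw [← trace_transpose]
      simp only [transpose_mul, transpose_transpose]
      rw [Matrix.mul_assoc, trace_mul_comm]
      simp only [Matrix.mul_assoc]
    rw [e, e2]; ring
  have h2 : 0 ≤ (Dᵀ * X * (Dᵀ * X)).trace := by
    nth_rw 1 [← h.eq]
    rw [← frobenius_norm_sq_eq_trace]; positivity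
  linarith

theorem mul_norm_sq_le_norm_mul_sq {l m n : Type*} [Fintype l] [Fintype m] [Fintype n]
    [DecidableEq n]
    {X : Matrix m n ℝ} (h : (Xᵀ * X).IsHermitian) (N : Matrix n l ℝ) :
    (⨅ i, h.eigenvalues i) * ‖N‖ ^ 2 ≤ ‖X * N‖ ^ 2 := by
  set U : Matrix n n ℝ := (h.eigenvectorUnitary : Matrix n n ℝ) with hU
  have hUU : U * Uᵀ = 1 := by
    simpa [star_eq_conjTranspose] using Unitary.mul_star_self_of_mem h.eigenvectorUnitary.2
  have hs : Xᵀ * X = U * diagonal h.eigenvalues * Uᵀ := by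
    have := h.spectral_theorem
    simpa [Unitary.conjStarAlgAut_apply, star_eq_conjTranspose, Function.comp_def] using this
  have e1 : ‖X * N‖ ^ 2 = ∑ j, ∑ i, h.eigenvalues i * (Uᵀ * N) i j ^ 2 := by
    rw [frobenius_norm_sq_eq_trace]
    have : (X * N)ᵀ * (X * N) = (Uᵀ * N)ᵀ * (diagonal h.eigenvalues * (Uᵀ * N)) := by
      clear_value U
      generalize h.eigenvalues = lam at hs ⊢
      rw [transpose_mul, Matrix.mul_assoc, ← Matrix.mul_assoc Xᵀ, hs]
      simp only [transpose_mul, transpose_transpose, Matrix.mul_assoc]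
    rw [this, trace]
    refine Finset.sum_congr rfl fun j _ => ?_
    rw [diag_apply, mul_apply]
    refine Finset.sum_congr rfl fun i _ => ?_
    rw [diagonal_mul, transpose_apply]; ring
  have e2 : ‖N‖ ^ 2 = ∑ j, ∑ i, (Uᵀ * N) i j ^ 2 := by
    rw [Finset.sum_comm, ← frobenius_norm_sq, frobenius_norm_sq_eq_trace,
      frobenius_norm_sq_eq_trace, transpose_mul, transpose_transpose, Matrix.mul_assoc,
      ← Matrix.mul_assoc U, hUU, Matrix.one_mul]
  rw [e1, e2, Finset.mul_sum]
  simp only [Finset.mul_sum]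
  gcongr with j _ i _
  exact ciInf_le (Set.finite_range _).bddBelow i

theorem iInf_eigenvalues_nonneg {m n : Type*} [Fintype m] [Fintype n] [DecidableEq n]
    {X : Matrix m n ℝ} (h : (Xᵀ * X).IsHermitian) : 0 ≤ ⨅ i, h.eigenvalues i :=
  Real.iInf_nonneg fun i => (posSemidef_conjTranspose_mul_self X).eigenvalues_nonneg i

theorem rank_mul_add_mul_le {p r : ℕ} (M P : Matrix (Fin p) (Fin r) ℝ)
    (N Q : Matrix (Fin r) (Fin p) ℝ) : (M * N + P * Q).rank ≤ 2 * r := by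
  rw [← fromCols_mul_fromRows]
  refine (rank_mul_le_left _ _).trans ((rank_le_card_width _).trans ?_)
  simp [two_mul]

/-- The regularity condition of the factored least-squares loss near an aligned solution. -/
theorem norm_sq_le_two_mul_inner {p r : ℕ} {F : Type*} [NormedAddCommGroup F]
    [InnerProductSpace ℝ F] (A : Matrix (Fin p) (Fin p) ℝ →ₗ[ℝ] F) {γ : ℝ}
    (hγ : γ ∈ Set.Ioo (0 : ℝ) 1)
    (hRIP : ∀ M : Matrix (Fin p) (Fin p) ℝ, M.IsSymm → M.rank ≤ 2 * r →
      (1 - γ) * ‖M‖ ^ 2 ≤ ‖A M‖ ^ 2 ∧ ‖A M‖ ^ 2 ≤ (1 + γ) * ‖M‖ ^ 2)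
    {Z X : Matrix (Fin p) (Fin r) ℝ} {σ : ℝ} (hσ : 0 ≤ σ)
    (hX : σ ^ 2 * ‖Z - X‖ ^ 2 ≤ ‖X * (Z - X)ᵀ‖ ^ 2) (hsymm : (Zᵀ * X).IsSymm)
    (hnear : ‖Z - X‖ ≤ 1 / 8 * ((1 - γ) / (1 + γ)) * σ) :
    ‖A (Z * Zᵀ - X * Xᵀ)‖ ^ 2 ≤
      2 * inner ℝ (A (Z * Zᵀ - X * Xᵀ)) (A (Z * (Z - X)ᵀ + (Z - X) * Zᵀ)) := by
  obtain ⟨hγ0, hγ1⟩ := hγ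
  set D := Z - X with hD
  have hZ : Z = X + D := by simp [hD]
  set E := Z * Zᵀ - X * Xᵀ with hE
  have hsum : Z * Dᵀ + D * Zᵀ = E + D * Dᵀ := by
    rw [hE, hZ]
    simp only [transpose_add, Matrix.add_mul, Matrix.mul_add]
    abel
  have hE' : E = (X * Dᵀ + D * Xᵀ) + D * Dᵀ := by
    rw [hE, hZ]
    simp only [transpose_add, Matrix.add_mul, Matrix.mul_add]
    abel
  have hDX : (Dᵀ * X).IsSymm := by
    rw [hD, transpose_sub, Matrix.sub_mul]
    exact hsymm.sub (by simp [Matrix.IsSymm])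
  have hr1 : E.rank ≤ 2 * r := by
    have := rank_mul_add_mul_le Z X Zᵀ (-Xᵀ)
    rwa [Matrix.mul_neg, ← sub_eq_add_neg] at this
  have hr2 : (D * Dᵀ).rank ≤ 2 * r := by
    have := rank_mul_add_mul_le D D Dᵀ 0
    rwa [Matrix.mul_zero, add_zero] at this
  have hEl := (hRIP E (by simp [hE, Matrix.IsSymm]) hr1).1
  have hDu := (hRIP (D * Dᵀ) (by simp [Matrix.IsSymm]) hr2).2
  have hlow := two_mul_norm_sq_le_norm_add_transpose_sq hDX
  have hDD : ‖D * Dᵀ‖ ≤ ‖D‖ ^ 2 := by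
    have := frobenius_norm_mul D Dᵀ
    rwa [frobenius_norm_transpose, ← sq] at this
  have htri : ‖X * Dᵀ + D * Xᵀ‖ ≤ ‖E‖ + ‖D * Dᵀ‖ := by
    have := norm_sub_le E (D * Dᵀ)
    rwa [hE', add_sub_cancel_right, ← hE'] at this
  generalize hq : (1 - γ) / (1 + γ) = q at hnear
  have hq0 : 0 ≤ q := by rw [← hq]; apply div_nonneg <;> linarith
  have hq1 : q ≤ 1 := by rw [← hq, div_le_one (by linarith)]; linarith
  have hqe : (1 + γ) * q = 1 - γ := by rw [← hq]; field_simp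
  have hd0 := norm_nonneg D
  have hdσ : ‖D‖ ≤ 1 / 8 * σ := by nlinarith
  have hEσ : σ * ‖D‖ ≤ ‖E‖ := by
    have h1 : (5 / 4 * (σ * ‖D‖)) ^ 2 ≤ ‖X * Dᵀ + D * Xᵀ‖ ^ 2 := by nlinarith [sq_nonneg (σ * ‖D‖)]
    have h2 := (sq_le_sq₀ (by positivity) (norm_nonneg _)).mp h1
    nlinarith
  have hEσ2 : σ ^ 2 * ‖D‖ ^ 2 ≤ ‖E‖ ^ 2 := by
    rw [← mul_pow]; exact pow_le_pow_left₀ (by positivity) hEσ 2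
  have hd2 : ‖D‖ ^ 2 ≤ 1 / 64 * q * σ ^ 2 := by
    have h1 := pow_le_pow_left₀ hd0 hnear 2
    have h2 : q * q * σ ^ 2 ≤ q * 1 * σ ^ 2 := by gcongr
    nlinarith
  have hb : ‖A (D * Dᵀ)‖ ^ 2 ≤ (1 / 8 * ‖A E‖) ^ 2 := by
    calc ‖A (D * Dᵀ)‖ ^ 2 ≤ (1 + γ) * ‖D * Dᵀ‖ ^ 2 := hDu
      _ ≤ (1 + γ) * (‖D‖ ^ 2) ^ 2 := by gcongr
      _ = (1 + γ) * (‖D‖ ^ 2 * ‖D‖ ^ 2) := by ring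
      _ ≤ (1 + γ) * (1 / 64 * q * σ ^ 2 * ‖D‖ ^ 2) := by gcongr
      _ = 1 / 64 * ((1 + γ) * q) * (σ ^ 2 * ‖D‖ ^ 2) := by ring
      _ ≤ 1 / 64 * (1 - γ) * ‖E‖ ^ 2 := by
        rw [hqe]
        have : 0 ≤ 1 - γ := by linarith
        gcongr
      _ ≤ (1 / 8 * ‖A E‖) ^ 2 := by linarith
  have hb' := (sq_le_sq₀ (norm_nonneg _) (by positivity)).mp hb
  have hcs := (abs_le.mp (abs_real_inner_le_norm (A E) (A (D * Dᵀ)))).1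
  rw [hsum, map_add, inner_add_right, real_inner_self_eq_norm_sq]
  nlinarith [norm_nonneg (A E)]

theorem inner_le_mul_norm {p r : ℕ} {F : Type*} [NormedAddCommGroup F]
    [InnerProductSpace ℝ F] (A : Matrix (Fin p) (Fin p) ℝ →ₗ[ℝ] F) {γ : ℝ}
    (hγ : γ ∈ Set.Ioo (0 : ℝ) 1)
    (hRIP : ∀ M : Matrix (Fin p) (Fin p) ℝ, M.IsSymm → M.rank ≤ 2 * r →
      (1 - γ) * ‖M‖ ^ 2 ≤ ‖A M‖ ^ 2 ∧ ‖A M‖ ^ 2 ≤ (1 + γ) * ‖M‖ ^ 2)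
    (v : F) (Z W : Matrix (Fin p) (Fin r) ℝ) :
    inner ℝ v (A (Z * Wᵀ + W * Zᵀ)) ≤ 4 * ‖v‖ * ‖Z‖ * ‖W‖ := by
  have h := (hRIP (Z * Wᵀ + W * Zᵀ) (by simp [Matrix.IsSymm, add_comm])
    (rank_mul_add_mul_le _ _ _ _)).2
  have h1 : ‖Z * Wᵀ + W * Zᵀ‖ ≤ 2 * (‖Z‖ * ‖W‖) := by
    have e1 := frobenius_norm_mul Z Wᵀ
    have e2 := frobenius_norm_mul W Zᵀ
    rw [frobenius_norm_transpose] at e1 e2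
    linarith [norm_add_le (Z * Wᵀ) (W * Zᵀ)]
  have h2 : ‖A (Z * Wᵀ + W * Zᵀ)‖ ^ 2 ≤ (4 * (‖Z‖ * ‖W‖)) ^ 2 := by
    have h3 := pow_le_pow_left₀ (norm_nonneg _) h1 2
    nlinarith [hγ.1, hγ.2]
  have h4 := (sq_le_sq₀ (norm_nonneg _) (by positivity)).mp h2
  calc inner ℝ v (A (Z * Wᵀ + W * Zᵀ)) ≤ ‖v‖ * ‖A (Z * Wᵀ + W * Zᵀ)‖ := real_inner_le_norm _ _
    _ ≤ ‖v‖ * (4 * (‖Z‖ * ‖W‖)) := by gcongr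
    _ = _ := by ring

end Frobenius

theorem inner_gradient_norm_sq_quadratic {V F : Type*} [NormedAddCommGroup V]
    [InnerProductSpace ℝ V] [FiniteDimensional ℝ V] [NormedAddCommGroup F]
    [InnerProductSpace ℝ F] (B : V →ₗ[ℝ] V →ₗ[ℝ] F) (y : F) (Z W : V) :
    inner ℝ (gradient (fun Z => ‖B Z Z - y‖ ^ 2) Z) W =
      2 * inner ℝ (B Z Z - y) (B Z W + B W Z) := by
  have hq : HasFDerivAt (fun Z => B.toContinuousBilinearMap Z Z - y) _ Z :=
    ((B.toContinuousBilinearMap.hasFDerivAt_of_bilinear (hasFDerivAt_id Z)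
      (hasFDerivAt_id Z))).sub_const y
  have h := hq.norm_sq
  simp only [LinearMap.toContinuousBilinearMap_apply] at h
  rw [inner_gradient_left, h.fderiv]
  simp [inner_add_right, two_mul, -map_sub, inner_sub_left]
  ring

/-- A sequence whose squared distance drops by at least `c` times a nonnegative quantity at every
step forces that quantity to tend to zero. -/
theorem tendsto_zero_of_mul_le_sub {d f : ℕ → ℝ} {c : ℝ} (hc : 0 < c) (hd : ∀ n, 0 ≤ d n)
    (hf : ∀ n, 0 ≤ f n) (h : ∀ n, c * f n ≤ d n - d (n + 1)) :
    Filter.Tendsto f Filter.atTop (nhds 0) := by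
  refine (summable_of_sum_range_le (c := d 0 / c) hf fun n => ?_).tendsto_atTop_zero
  rw [le_div_iff₀' hc, Finset.mul_sum]
  calc ∑ i ∈ Finset.range n, c * f i ≤ ∑ i ∈ Finset.range n, (d i - d (i + 1)) :=
        Finset.sum_le_sum fun i _ => h i
    _ = d 0 - d n := Finset.sum_range_sub' d n
    _ ≤ d 0 := sub_le_self _ (hd n)

open scoped Matrix.Norms.Frobenius in
/-- Theorem 3.1 of the paper: explicit basin of attraction for Burer–Monteiro low-rank
PSD matrix recovery. Under the RIP with constant `γ` on symmetric matrices of rank at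
most `2r`, with `y = A(Z₀Z₀ᵀ)` (noiseless case) and
`β_LR = (1/8)(1-γ)σ_min(Z₀)²/((1+γ)σ_max(Z₀))`, the set
`{Z : inf_{H ∈ O(r)} ‖ZH - Z₀‖_F < β_LR}` is a `g`-basin of attraction of `Z₀`. -/
theorem stmt_7 {p r m : ℕ} (hp : 1 ≤ p) (hr : 1 ≤ r) (hm : 1 ≤ m) (hrp : r ≤ p)
    (A : Matrix (Fin p) (Fin p) ℝ →ₗ[ℝ] EuclideanSpace ℝ (Fin m))
    (γ : ℝ) (hγ : γ ∈ Set.Ioo (0 : ℝ) 1)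
    (hRIP : ∀ M : Matrix (Fin p) (Fin p) ℝ, M.IsSymm → M.rank ≤ 2 * r →
      (1 - γ) * (∑ i, ∑ j, M i j ^ 2) ≤ ‖A M‖ ^ 2 ∧
        ‖A M‖ ^ 2 ≤ (1 + γ) * (∑ i, ∑ j, M i j ^ 2))
    (Z0 : Matrix (Fin p) (Fin r) ℝ) (hZ0 : Z0.rank = r)
    (hherm : (Z0ᵀ * Z0).IsHermitian)
    (σmax σmin : ℝ)
    (hσmax : σmax = Real.sqrt (⨆ i, hherm.eigenvalues i))
    (hσmin : σmin = Real.sqrt (⨅ i, hherm.eigenvalues i))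
    (y : EuclideanSpace ℝ (Fin m)) (hy : y = A (Z0 * Z0ᵀ))
    (toMat : EuclideanSpace ℝ (Fin p × Fin r) → Matrix (Fin p) (Fin r) ℝ)
    (htoMat : ∀ Z i k, toMat Z i k = Z (i, k))
    (g : EuclideanSpace ℝ (Fin p × Fin r) → ℝ)
    (hg : g = fun Z => ‖A (toMat Z * (toMat Z)ᵀ) - y‖ ^ 2)
    (βLR : ℝ) (hβLR : βLR = 1 / 8 * ((1 - γ) * σmin ^ 2) / ((1 + γ) * σmax)) :
    ∃ τ : ℝ, 0 < τ ∧ ∀ Z : ℕ → EuclideanSpace ℝ (Fin p × Fin r),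
      sInf {c : ℝ | ∃ Ho : Matrix (Fin r) (Fin r) ℝ, Hoᵀ * Ho = 1 ∧
          c = Real.sqrt (∑ i, ∑ j, (toMat (Z 0) * Ho - Z0) i j ^ 2)} < βLR →
      (∀ n : ℕ, Z (n + 1) = Z n - τ • gradient g (Z n)) →
      Filter.Tendsto (fun n => g (Z n)) Filter.atTop (nhds 0) := by
  obtain ⟨hγ0, hγ1⟩ := id hγ
  rcases le_or_gt βLR 0 with hβ | hβ
  · refine ⟨1, one_pos, fun Z hZ _ => absurd hZ (not_lt.mpr (hβ.trans (Real.sInf_nonneg ?_)))⟩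
    rintro c ⟨Ho, -, rfl⟩
    exact Real.sqrt_nonneg _
  have : Nonempty (Fin r) := ⟨⟨0, hr⟩⟩
  have hσ0 : 0 ≤ σmin := hσmin ▸ Real.sqrt_nonneg _
  have hσ2 : σmin ^ 2 = ⨅ i, hherm.eigenvalues i := by
    rw [hσmin, Real.sq_sqrt (iInf_eigenvalues_nonneg hherm)]
  have hσσ : σmin ≤ σmax := by
    rw [hσmin, hσmax]
    exact Real.sqrt_le_sqrt (ciInf_le_ciSup (Set.finite_range _).bddBelow
      (Set.finite_range _).bddAbove)
  have hβσ : βLR ≤ 1 / 8 * ((1 - γ) / (1 + γ)) * σmin := by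
    have hmax : 0 < σmax := by
      refine (hσ0.trans hσσ).lt_of_ne fun h => ?_
      rw [hβLR, ← h] at hβ
      simp at hβ
    have h1 : σmin ^ 2 / σmax ≤ σmin := by
      rw [div_le_iff₀ hmax]; nlinarith
    have h2 : 0 ≤ 1 / 8 * ((1 - γ) / (1 + γ)) :=
      mul_nonneg (by norm_num) (div_nonneg (by linarith) (by linarith))
    calc βLR = 1 / 8 * ((1 - γ) / (1 + γ)) * (σmin ^ 2 / σmax) := by rw [hβLR]; field_simp
      _ ≤ _ := by gcongr
  let T : EuclideanSpace ℝ (Fin p × Fin r) →ₗ[ℝ] Matrix (Fin p) (Fin r) ℝ :=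
    { toFun := toMat
      map_add' := fun x y => by ext i j; simp [htoMat]
      map_smul' := fun c x => by ext i j; simp [htoMat] }
  have hTapp (x) : T x = toMat x := rfl
  have hTnorm (x) : ‖T x‖ = ‖x‖ := by
    refine (sq_eq_sq₀ (norm_nonneg _) (norm_nonneg _)).mp ?_
    rw [frobenius_norm_sq, EuclideanSpace.real_norm_sq_eq, Fintype.sum_prod_type]
    simp [hTapp, htoMat]
  have hTsurj (M) : ∃ x, T x = M :=
    ⟨WithLp.toLp 2 fun ij => M ij.1 ij.2, by ext i j; simp [hTapp, htoMat]⟩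
  simp only [← frobenius_norm_sq, ← hTapp, Real.sqrt_sq (norm_nonneg _)] at hRIP hg ⊢
  let B : EuclideanSpace ℝ (Fin p × Fin r) →ₗ[ℝ] EuclideanSpace ℝ (Fin p × Fin r) →ₗ[ℝ]
      EuclideanSpace ℝ (Fin m) :=
    LinearMap.mk₂ ℝ (fun Z W => A (T Z * (T W)ᵀ))
      (by intros; simp [Matrix.add_mul]) (by intros; simp)
      (by intros; simp [Matrix.mul_add]) (by intros; simp)
  have hgrad (Z W) : inner ℝ (gradient g Z) W =
      2 * inner ℝ (A (T Z * (T Z)ᵀ) - y) (A (T Z * (T W)ᵀ + T W * (T Z)ᵀ)) := by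
    rw [hg, map_add]
    exact inner_gradient_norm_sq_quadratic B y Z W
  have hgnn (Z) : 0 ≤ g Z := by rw [hg]; positivity
  set L : ℝ := 64 * (‖Z0‖ + βLR) ^ 2 with hL
  have hLpos : 0 < L := by positivity
  refine ⟨1 / L, by positivity, fun Z hinit hstep => ?_⟩
  choose Q hQ hQsymm hQmin using fun n => exists_orthogonal_aligned (T (Z n)) Z0
  set d : ℕ → ℝ := fun n => ‖T (Z n) - Z0 * Q n‖ with hd
  have hdesc (n : ℕ) (hn : d n < βLR) : 1 / L * g (Z n) ≤ d n ^ 2 - d (n + 1) ^ 2 := by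
    obtain ⟨X, hX⟩ := hTsurj (Z0 * Q n)
    have hXn : ‖T X‖ = ‖Z0‖ := by rw [hX, frobenius_norm_mul_orthogonal _ (hQ n)]
    have hXX : T X * (T X)ᵀ = Z0 * Z0ᵀ := by
      rw [hX, transpose_mul, Matrix.mul_assoc, ← Matrix.mul_assoc (Q n),
        mul_eq_one_comm.mp (hQ n), Matrix.one_mul]
    have hres : A (T (Z n) * (T (Z n))ᵀ) - y = A (T (Z n) * (T (Z n))ᵀ - T X * (T X)ᵀ) := by
      rw [hXX, map_sub, hy]
    have hga : g (Z n) = ‖A (T (Z n) * (T (Z n))ᵀ) - y‖ ^ 2 := by rw [hg]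
    have hdn : d n = ‖T (Z n) - T X‖ := by rw [hX]
    have hreg : g (Z n) ≤ inner ℝ (gradient g (Z n)) (Z n - X) := by
      rw [hgrad, map_sub, hga, hres]
      refine norm_sq_le_two_mul_inner A hγ hRIP hσ0 ?_ ?_ ?_
      · have h := mul_norm_sq_le_norm_mul_sq hherm (Q n * (T (Z n) - T X)ᵀ)
        have hQ' : ‖Q n * (T (Z n) - T X)ᵀ‖ = ‖T (Z n) - T X‖ := by
          rw [← frobenius_norm_transpose, transpose_mul, transpose_transpose]
          refine frobenius_norm_mul_orthogonal _ ?_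
          rw [transpose_transpose, mul_eq_one_comm.mp (hQ n)]
        rwa [hQ', ← Matrix.mul_assoc, ← hX, ← hσ2] at h
      · rw [hX]; exact hQsymm n
      · rw [← hdn]; exact hn.le.trans hβσ
    have hZn : ‖T (Z n)‖ ≤ ‖Z0‖ + βLR := by
      have h := norm_add_le (T X) (T (Z n) - T X)
      rw [add_sub_cancel, hXn, ← hdn] at h
      linarith
    have hG : ‖gradient g (Z n)‖ ^ 2 ≤ L * g (Z n) := by
      set G := gradient g (Z n) with hGdef
      have h1 : ‖G‖ ^ 2 ≤ 2 * (4 * ‖A (T (Z n) * (T (Z n))ᵀ) - y‖ * ‖T (Z n)‖ * ‖T G‖) := by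
        rw [← real_inner_self_eq_norm_sq]
        nth_rw 1 [hGdef]
        rw [hgrad]
        gcongr
        exact inner_le_mul_norm A hγ hRIP _ _ _
      rw [hTnorm G] at h1
      have h2 : ‖G‖ ≤ 8 * ‖A (T (Z n) * (T (Z n))ᵀ) - y‖ * (‖Z0‖ + βLR) := by
        rcases (norm_nonneg G).eq_or_lt with h0 | h0
        · rw [← h0]; positivity
        · have h3 : ‖G‖ ≤ 8 * ‖A (T (Z n) * (T (Z n))ᵀ) - y‖ * ‖T (Z n)‖ := by
            refine le_of_mul_le_mul_right ?_ h0
            nlinarith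
          exact h3.trans (by gcongr)
      calc ‖G‖ ^ 2 ≤ (8 * ‖A (T (Z n) * (T (Z n))ᵀ) - y‖ * (‖Z0‖ + βLR)) ^ 2 := by gcongr
        _ = L * g (Z n) := by rw [hga, hL]; ring
    have hnext : d (n + 1) ^ 2 ≤ ‖(Z n - X) - (1 / L) • gradient g (Z n)‖ ^ 2 := by
      refine pow_le_pow_left₀ (norm_nonneg _) ((hQmin (n + 1) (Q n) (hQ n)).trans_eq ?_) 2
      rw [← hX, ← map_sub, hTnorm, hstep n, sub_right_comm]
    rw [norm_sub_sq_real (Z n - X), inner_smul_right, norm_smul, mul_pow, real_inner_comm,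
      Real.norm_of_nonneg (by positivity : 0 ≤ 1 / L)] at hnext
    rw [hdn, ← map_sub, hTnorm]
    have h1 : (1 / L) * g (Z n) ≤ (1 / L) * inner ℝ (gradient g (Z n)) (Z n - X) := by gcongr
    have h2 : (1 / L) ^ 2 * ‖gradient g (Z n)‖ ^ 2 ≤ 1 / L * g (Z n) := by
      calc (1 / L) ^ 2 * ‖gradient g (Z n)‖ ^ 2 ≤ (1 / L) ^ 2 * (L * g (Z n)) := by gcongr
        _ = 1 / L * g (Z n) := by field_simp
    linarith
  have hd0 : d 0 < βLR := by
    obtain ⟨c, ⟨H, hH, rfl⟩, hc⟩ := exists_lt_of_csInf_lt (by exact ⟨_, 1, by simp, rfl⟩) hinit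
    have hH' : H * Hᵀ = 1 := mul_eq_one_comm.mp hH
    refine (hQmin 0 Hᵀ (by rw [transpose_transpose, hH'])).trans_lt (lt_of_eq_of_lt ?_ hc)
    rw [← frobenius_norm_mul_orthogonal _ hH, Matrix.sub_mul, Matrix.mul_assoc, hH,
      Matrix.mul_one]
  have hdn (n : ℕ) : d n < βLR := by
    induction n with
    | zero => exact hd0
    | succ n ih =>
      have h1 := hdesc n ih
      have h2 : 0 ≤ 1 / L * g (Z n) := mul_nonneg (by positivity) (hgnn _)
      have h3 : d (n + 1) ≤ d n :=
        (sq_le_sq₀ (norm_nonneg _) (norm_nonneg _)).mp (by linarith)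
      exact h3.trans_lt ih
  exact tendsto_zero_of_mul_le_sub (d := fun n => d n ^ 2) (by positivity)
    (fun n => sq_nonneg _) (fun n => hgnn _) fun n => hdesc n (hdn n)
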